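/- arXiv:1406.2982 — 3 statements merged into one kernel-verified Lean document; each statement's English description precedes it below -/
import Mathlib

section
/- For all sets A, B ⊆ ℕ, if B is mod-finite reducible to A then B is use-bounded-from-below reducible to A. -/
open Filter

/-- A finite record of oracle query answers: a finite list of (position, bit) pairs. -/
abbrev FinInfo : Type := List (ℕ × Bool)

/-- Two finite query-answer records are compatible if they agree wherever both answer. -/
def FinInfo.Compatible (σ τ : FinInfo) : Prop :=
  ∀ p ∈ σ, ∀ q ∈ τ, p.1 = q.1 → p.2 = q.2

/-- The answers recorded in `σ` are exactly those given by the characteristic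
function of the set `C`. -/
def AgreesSet (σ : FinInfo) (C : Set ℕ) : Prop :=
  ∀ p ∈ σ, (p.2 = true ↔ p.1 ∈ C)

/-- The answers recorded in `σ` are all given by the partial oracle `g`. -/
def AgreesPart (σ : FinInfo) (g : ℕ →. Bool) : Prop :=
  ∀ p ∈ σ, p.2 ∈ g p.1

/-- `g` is a partial oracle for the set `A`: a partial function from `ℕ` to `Bool`
agreeing with the characteristic function of `A` on its domain. -/
def IsPartialOracle (g : ℕ →. Bool) (A : Set ℕ) : Prop :=
  ∀ n b, b ∈ g n → (b = true ↔ n ∈ A)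

/-- The domain of a partial oracle. -/
def pDom (g : ℕ →. Bool) : Set ℕ := {n | (g n).Dom}

/-- A Turing functional (oracle Turing machine program), presented as a computable
enumeration of axioms `(σ, n, b)`, meaning: if the oracle answers the queries
recorded in `σ` as `σ` prescribes, then the machine halts on input `n` with
output `b`.  Oracle queries are made in parallel, so with a partial oracle the
machine halts on `n` iff some axiom for `n` is answered by the partial oracle.
Determinism of the machine is reflected in the requirement that axioms with
compatible query answers give equal outputs. -/
structure TuringFunctional where
  axs : ℕ → Option (FinInfo × ℕ × Bool)
  axs_computable : Computable axs
  consistent : ∀ k₁ k₂ σ₁ σ₂ n b₁ b₂, axs k₁ = some (σ₁, n, b₁) →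
    axs k₂ = some (σ₂, n, b₂) → σ₁.Compatible σ₂ → b₁ = b₂

namespace TuringFunctional

/-- `Φ^C(n)` halts with output `b` (total oracle `C`). -/
def HaltsT (Φ : TuringFunctional) (C : Set ℕ) (n : ℕ) (b : Bool) : Prop :=
  ∃ k σ, Φ.axs k = some (σ, n, b) ∧ AgreesSet σ C

/-- `Φ^g(n)` halts with output `b` (partial oracle `g`). -/
def HaltsP (Φ : TuringFunctional) (g : ℕ →. Bool) (n : ℕ) (b : Bool) : Prop :=
  ∃ k σ, Φ.axs k = some (σ, n, b) ∧ AgreesPart σ g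

/-- `Φ^C` is total. -/
def TotalOn (Φ : TuringFunctional) (C : Set ℕ) : Prop := ∀ n, ∃ b, Φ.HaltsT C n b

/-- The set `{n : Φ^C(n) = B(n)}` on which `Φ^C` halts and agrees with the
characteristic function of `B`. -/
def AgreeSet (Φ : TuringFunctional) (C B : Set ℕ) : Set ℕ :=
  {n | ∃ b, Φ.HaltsT C n b ∧ (b = true ↔ n ∈ B)}

/-- `Φ^A = B`: with oracle `A`, `Φ` is total and computes the characteristic
function of `B`. -/
def FunEq (Φ : TuringFunctional) (A B : Set ℕ) : Prop :=
  Φ.TotalOn A ∧ ∀ n b, Φ.HaltsT A n b → (b = true ↔ n ∈ B)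

/-- `Φ^g ≃ B`: every halting output of `Φ` with partial oracle `g` agrees with
the characteristic function of `B`. -/
def PAgrees (Φ : TuringFunctional) (g : ℕ →. Bool) (B : Set ℕ) : Prop :=
  ∀ n b, Φ.HaltsP g n b → (b = true ↔ n ∈ B)

/-- The domain of `Φ^g`. -/
def PDomain (Φ : TuringFunctional) (g : ℕ →. Bool) : Set ℕ :=
  {n | ∃ b, Φ.HaltsP g n b}

/-- The axiom with index `k` applies to oracle `C` on input `n`. -/
def AppliesAt (Φ : TuringFunctional) (C : Set ℕ) (n k : ℕ) : Prop :=
  ∃ σ b, Φ.axs k = some (σ, n, b) ∧ AgreesSet σ C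

/-- The (halting) computation of `Φ^C(n)` queries the oracle bit `C(m)`:
the first axiom in the enumeration that applies to `C` on input `n`
records an answer to a query at position `m`. -/
def QueriesAt (Φ : TuringFunctional) (C : Set ℕ) (n m : ℕ) : Prop :=
  ∃ k σ b, Φ.axs k = some (σ, n, b) ∧ AgreesSet σ C ∧
    (∀ k' < k, ¬ Φ.AppliesAt C n k') ∧ ∃ p ∈ σ, p.1 = m

end TuringFunctional

/-- `D ⊆ ℕ` has (asymptotic) density 1. -/
def DensityOne (D : Set ℕ) : Prop :=
  Filter.Tendsto (fun n : ℕ => ((D ∩ Set.Iio n).ncard : ℝ) / n) Filter.atTop (nhds 1)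

/-- `B ≤₁ A`: 1-reducibility. -/
def OneRed (B A : Set ℕ) : Prop :=
  ∃ f : ℕ → ℕ, Computable f ∧ Function.Injective f ∧ ∀ n, n ∈ B ↔ f n ∈ A

/-- `B ≤_T A`: Turing reducibility. -/
def TuringRed (B A : Set ℕ) : Prop :=
  ∃ Φ : TuringFunctional, Φ.FunEq A B

/-- `B ≤_mr A`: mod-recursive reducibility. -/
def ModRecRed (B A : Set ℕ) : Prop :=
  ∃ Φ : TuringFunctional, Φ.FunEq A B ∧
    ∀ C : Set ℕ, ComputablePred (fun n => (n ∈ C ↔ n ∈ A)) →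
      Φ.TotalOn C ∧ ComputablePred (fun n => n ∈ Φ.AgreeSet C B)

/-- `B ≤_mf A`: mod-finite reducibility. -/
def ModFinRed (B A : Set ℕ) : Prop :=
  ∃ Φ : TuringFunctional, Φ.FunEq A B ∧
    ∀ C : Set ℕ, {n | ¬ (n ∈ C ↔ n ∈ A)}.Finite →
      Φ.TotalOn C ∧ (Φ.AgreeSet C B)ᶜ.Finite

/-- `B ≤_cor A`: coarse reducibility. -/
def CoarseRed (B A : Set ℕ) : Prop :=
  ∃ Φ : TuringFunctional,
    ∀ C : Set ℕ, DensityOne {n | n ∈ C ↔ n ∈ A} →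
      Φ.TotalOn C ∧ DensityOne (Φ.AgreeSet C B)

/-- `B ≤_cf A`: cofinite reducibility. -/
def CofinRed (B A : Set ℕ) : Prop :=
  ∃ Φ : TuringFunctional, Φ.FunEq A B ∧
    ∀ g : ℕ →. Bool, IsPartialOracle g A → (pDom g)ᶜ.Finite →
      Φ.PAgrees g B ∧ (Φ.PDomain g)ᶜ.Finite

/-- `B ≤_g A`: generic reducibility. -/
def GenericRed (B A : Set ℕ) : Prop :=
  ∃ Φ : TuringFunctional, Φ.FunEq A B ∧
    ∀ g : ℕ →. Bool, IsPartialOracle g A → DensityOne (pDom g) →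
      Φ.PAgrees g B ∧ DensityOne (Φ.PDomain g)

/-- `B ≤_ii A`: infinite-information reducibility. -/
def IIRed (B A : Set ℕ) : Prop :=
  ∃ Φ : TuringFunctional,
    ∀ g : ℕ →. Bool, IsPartialOracle g A → (pDom g).Infinite →
      Φ.PAgrees g B ∧ (Φ.PDomain g).Infinite

/-- `B ≤_ubfb A`: use-bounded-from-below reducibility. -/
def UbfbRed (B A : Set ℕ) : Prop :=
  ∃ Φ : TuringFunctional, Φ.FunEq A B ∧
    ∀ m : ℕ, ∀ᶠ n in Filter.atTop, ¬ Φ.QueriesAt A n m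

/-- `R(S) = {2^n · m : n ∈ S, m odd}`. -/
def Rmap (S : Set ℕ) : Set ℕ :=
  {x | ∃ n ∈ S, ∃ m : ℕ, Odd m ∧ x = 2 ^ n * m}

/-- `R̃(S) = {2^n + m : n ∈ S, m < 2^n}`. -/
def Rtilde (S : Set ℕ) : Set ℕ :=
  {x | ∃ n ∈ S, ∃ m : ℕ, m < 2 ^ n ∧ x = 2 ^ n + m}

/-- The Turing join `A ⊕ B`. -/
def turingJoin (A B : Set ℕ) : Set ℕ :=
  {x | (∃ n ∈ A, x = 2 * n) ∨ (∃ n ∈ B, x = 2 * n + 1)}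

/-- Lists of natural numbers representing all the subsets of `{0, …, m - 1}`. -/
def subsetLists (m : ℕ) : List (List ℕ) :=
  Nat.rec [[]] (fun k l => l ++ l.map (fun r => k :: r)) m

theorem exists_mem_subsetLists (C : Set ℕ) (m : ℕ) :
    ∃ r ∈ subsetLists m, ∀ x < m, x ∈ r ↔ x ∈ C := by
  suffices ∃ r ∈ subsetLists m, ∀ x, x ∈ r ↔ x < m ∧ x ∈ C by
    obtain ⟨r, hr, h⟩ := this
    exact ⟨r, hr, fun x hx => by simp [h, hx]⟩
  induction m with
  | zero => exact ⟨[], by simp [subsetLists], by simp⟩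
  | succ k ih =>
    obtain ⟨r, hr, h⟩ := ih
    have hs : subsetLists (k + 1) =
      subsetLists k ++ (subsetLists k).map (fun r => k :: r) := rfl
    by_cases hk : k ∈ C
    · refine ⟨k :: r, by rw [hs]; simp [hr], fun x => ?_⟩
      rw [List.mem_cons, h, Nat.lt_succ_iff_lt_or_eq]
      constructor
      · rintro (rfl | h)
        · exact ⟨Or.inr rfl, hk⟩
        · exact ⟨Or.inl h.1, h.2⟩
      · rintro ⟨h | h, hx⟩
        · exact Or.inr ⟨h, hx⟩
        · exact Or.inl h
    · refine ⟨r, by rw [hs]; simp [hr], fun x => ?_⟩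
      rw [h, Nat.lt_succ_iff_lt_or_eq]
      constructor
      · exact fun h => ⟨Or.inl h.1, h.2⟩
      · rintro ⟨h | rfl, hx⟩
        · exact ⟨h, hx⟩
        · exact absurd hx hk

/-- The set that agrees with (the set of members of) `r` below `m` and with `C` from `m` on. -/
def modifyBelow (C : Set ℕ) (m : ℕ) (r : List ℕ) : Set ℕ :=
  {x | (x < m ∧ x ∈ r) ∨ (m ≤ x ∧ x ∈ C)}

theorem modifyBelow_eq_self {C : Set ℕ} {m : ℕ} {r : List ℕ} (h : ∀ x < m, x ∈ r ↔ x ∈ C) :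
    modifyBelow C m r = C := by
  ext x
  rcases lt_or_ge x m with hx | hx
  · simp [modifyBelow, hx, h x hx, not_le.2 hx]
  · simp [modifyBelow, hx, not_lt.2 hx]

theorem finite_modifyBelow_diff (C : Set ℕ) (m : ℕ) (r : List ℕ) :
    {n | ¬ (n ∈ modifyBelow C m r ↔ n ∈ C)}.Finite := by
  refine (Set.finite_Iio m).subset fun x hx => ?_
  by_contra hm
  have hm : m ≤ x := not_lt.1 hm
  exact hx (by simp [modifyBelow, hm, not_lt.2 hm])

/-- The answers to queries at `m` and above recorded in `τ`, together with the answers below `m`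
given by `r`, include the answer `p`. -/
def AnsweredBy (m : ℕ) (r : List ℕ) (τ : FinInfo) (p : ℕ × Bool) : Prop :=
  (p.1 < m ∧ (p.2 = true ↔ p.1 ∈ r)) ∨ (m ≤ p.1 ∧ p ∈ τ)

/-- Some axiom in the list `S` gives output `b` on input `n`, with all of its queries
answered by `r` below `m` and by `τ` from `m` on. -/
def OutputFrom (S : List (FinInfo × ℕ × Bool)) (m : ℕ) (r : List ℕ) (τ : FinInfo)
    (n : ℕ) (b : Bool) : Prop :=
  ∃ a ∈ S, a.2 = (n, b) ∧ ∀ p ∈ a.1, AnsweredBy m r τ p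

/-- The consistent record `τ` has no queries below `m` and forces output `b` on input `n`
whatever the oracle is below `m`, whereas (unless `m = n`) the part of `τ` above `m` is compatible
with two different outputs. -/
def ForcesFrom (S : List (FinInfo × ℕ × Bool)) (τ : FinInfo) (m n : ℕ) (b : Bool) : Prop :=
  (∀ p ∈ τ, m ≤ p.1) ∧ (∀ p ∈ τ, ∀ q ∈ τ, p.1 = q.1 → p.2 = q.2) ∧
  (∀ r ∈ subsetLists m, OutputFrom S m r τ n b) ∧
  (m = n ∨ ((∃ r ∈ subsetLists (m + 1), OutputFrom S (m + 1) r τ n true) ∧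
    (∃ r ∈ subsetLists (m + 1), OutputFrom S (m + 1) r τ n false)))

open Classical in
/-- The axiom described by `t = (τ, m, n, b, _)` if it is forced by `S`. -/
noncomputable def forcedAxiom (S : List (FinInfo × ℕ × Bool)) (t : FinInfo × ℕ × ℕ × Bool × ℕ) :
    Option (FinInfo × ℕ × Bool) :=
  if ForcesFrom S t.1 t.2.1 t.2.2.1 t.2.2.2.1 then some (t.1, t.2.2.1, t.2.2.2.1) else none

theorem forcedAxiom_eq_some {S : List (FinInfo × ℕ × Bool)} {t : FinInfo × ℕ × ℕ × Bool × ℕ}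
    {σ : FinInfo} {n : ℕ} {b : Bool} :
    forcedAxiom S t = some (σ, n, b) ↔
      ForcesFrom S σ t.2.1 n b ∧ t.1 = σ ∧ t.2.2.1 = n ∧ t.2.2.2.1 = b := by
  unfold forcedAxiom
  split_ifs with f
  · rw [Option.some.injEq, Prod.mk.injEq, Prod.mk.injEq]
    refine ⟨?_, fun h => h.2⟩
    rintro ⟨rfl, rfl, rfl⟩
    exact ⟨f, rfl, rfl, rfl⟩
  · refine iff_of_false (by simp) ?_
    rintro ⟨g, rfl, rfl, rfl⟩
    exact f g

section Computability

variable {α β : Type*} [Primcodable α] [Primcodable β]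

theorem PrimrecPred.exists_mem_list_param {f : α → List β} {P : α → β → Prop} (hf : Primrec f)
    (hP : PrimrecPred fun x : α × β => P x.1 x.2) : PrimrecPred fun x => ∃ a ∈ f x, P x a := by
  have h : PrimrecRel fun (a : β) (x : α) => P x a :=
    hP.comp (f := fun y : β × α => (y.2, y.1)) (Primrec.snd.pair Primrec.fst)
  exact h.exists_mem_list.comp hf Primrec.id

theorem PrimrecPred.forall_mem_list_param {f : α → List β} {P : α → β → Prop} (hf : Primrec f)
    (hP : PrimrecPred fun x : α × β => P x.1 x.2) : PrimrecPred fun x => ∀ a ∈ f x, P x a := by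
  have h : PrimrecRel fun (a : β) (x : α) => P x a :=
    hP.comp (f := fun y : β × α => (y.2, y.1)) (Primrec.snd.pair Primrec.fst)
  exact h.forall_mem_list.comp hf Primrec.id

theorem PrimrecPred.mem_list {f : α → List β} {g : α → β} (hf : Primrec f) (hg : Primrec g) :
    PrimrecPred fun x => g x ∈ f x := by
  refine (PrimrecPred.exists_mem_list_param (P := fun x b => b = g x) hf
    (Primrec.eq.comp Primrec.snd (hg.comp Primrec.fst))).of_eq fun x => ?_
  simp

theorem PrimrecPred.iff {P Q : α → Prop} (hP : PrimrecPred P) (hQ : PrimrecPred Q) :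
    PrimrecPred fun x => P x ↔ Q x := by
  refine ((hP.and hQ).or (hP.not.and hQ.not)).of_eq fun x => ?_
  tauto

theorem PrimrecPred.imp {P Q : α → Prop} (hP : PrimrecPred P) (hQ : PrimrecPred Q) :
    PrimrecPred fun x => P x → Q x := by
  refine (hP.not.or hQ).of_eq fun x => ?_
  tauto

theorem primrec_subsetLists : Primrec subsetLists := by
  refine Primrec.nat_rec₁ (f := fun k (l : List (List ℕ)) => l ++ l.map (fun r => k :: r)) [[]] ?_
  refine Primrec.list_append.comp Primrec.snd (Primrec.list_map Primrec.snd ?_)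
  exact Primrec.list_cons.comp (Primrec.fst.comp Primrec.fst) Primrec.snd

theorem primrecPred_answeredBy {m : α → ℕ} {r : α → List ℕ} {τ : α → FinInfo} {p : α → ℕ × Bool}
    (hm : Primrec m) (hr : Primrec r) (hτ : Primrec τ) (hp : Primrec p) :
    PrimrecPred fun x => AnsweredBy (m x) (r x) (τ x) (p x) := by
  have hp1 : Primrec fun x => (p x).1 := Primrec.fst.comp hp
  have hp2 : Primrec fun x => (p x).2 := Primrec.snd.comp hp
  exact ((Primrec.nat_lt.comp hp1 hm).and
    ((Primrec.eq.comp hp2 (Primrec.const true)).iff (PrimrecPred.mem_list hr hp1))).or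
    ((Primrec.nat_le.comp hm hp1).and (PrimrecPred.mem_list hτ hp))

theorem primrecPred_outputFrom {S : α → List (FinInfo × ℕ × Bool)} {m : α → ℕ} {r : α → List ℕ}
    {τ : α → FinInfo} {n : α → ℕ} {b : α → Bool} (hS : Primrec S) (hm : Primrec m)
    (hr : Primrec r) (hτ : Primrec τ) (hn : Primrec n) (hb : Primrec b) :
    PrimrecPred fun x => OutputFrom (S x) (m x) (r x) (τ x) (n x) (b x) := by
  refine PrimrecPred.exists_mem_list_param hS (PrimrecPred.and ?_ ?_)
  · exact Primrec.eq.comp (Primrec.snd.comp Primrec.snd) ((hn.pair hb).comp Primrec.fst)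
  · refine PrimrecPred.forall_mem_list_param
      (f := fun x : α × (FinInfo × ℕ × Bool) => x.2.1) (Primrec.fst.comp Primrec.snd) ?_
    have h : Primrec fun x : (α × (FinInfo × ℕ × Bool)) × (ℕ × Bool) => x.1.1 :=
      Primrec.fst.comp Primrec.fst
    exact primrecPred_answeredBy (hm.comp h) (hr.comp h) (hτ.comp h) Primrec.snd

theorem primrecPred_forcesFrom {S : α → List (FinInfo × ℕ × Bool)} {τ : α → FinInfo}
    {m n : α → ℕ} {b : α → Bool} (hS : Primrec S) (hτ : Primrec τ) (hm : Primrec m)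
    (hn : Primrec n) (hb : Primrec b) :
    PrimrecPred fun x => ForcesFrom (S x) (τ x) (m x) (n x) (b x) := by
  have split (b : Bool) : PrimrecPred fun x =>
      ∃ r ∈ subsetLists (m x + 1), OutputFrom (S x) (m x + 1) r (τ x) (n x) b :=
    PrimrecPred.exists_mem_list_param (primrec_subsetLists.comp (Primrec.succ.comp hm))
      (primrecPred_outputFrom (hS.comp Primrec.fst) (Primrec.succ.comp (hm.comp Primrec.fst))
        Primrec.snd (hτ.comp Primrec.fst) (hn.comp Primrec.fst) (Primrec.const b))
  refine PrimrecPred.and ?_ (PrimrecPred.and ?_ (PrimrecPred.and ?_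
    ((Primrec.eq.comp hm hn).or ((split true).and (split false)))))
  · exact PrimrecPred.forall_mem_list_param hτ
      (Primrec.nat_le.comp (hm.comp Primrec.fst) (Primrec.fst.comp Primrec.snd))
  · refine PrimrecPred.forall_mem_list_param hτ
      (PrimrecPred.forall_mem_list_param (hτ.comp Primrec.fst) (PrimrecPred.imp ?_ ?_))
    · exact Primrec.eq.comp (Primrec.fst.comp (Primrec.snd.comp Primrec.fst))
        (Primrec.fst.comp Primrec.snd)
    · exact Primrec.eq.comp (Primrec.snd.comp (Primrec.snd.comp Primrec.fst))
        (Primrec.snd.comp Primrec.snd)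
  · exact PrimrecPred.forall_mem_list_param (primrec_subsetLists.comp hm)
      (primrecPred_outputFrom (hS.comp Primrec.fst) (hm.comp Primrec.fst) Primrec.snd
        (hτ.comp Primrec.fst) (hn.comp Primrec.fst) (hb.comp Primrec.fst))

theorem primrec_forcedAxiom : Primrec₂ forcedAxiom := by
  classical
  have h2 : Primrec fun x : List (FinInfo × ℕ × Bool) × (FinInfo × ℕ × ℕ × Bool × ℕ) => x.2 :=
    Primrec.snd
  have hτ := Primrec.fst.comp h2
  have hm := Primrec.fst.comp (Primrec.snd.comp h2)
  have hn := Primrec.fst.comp (Primrec.snd.comp (Primrec.snd.comp h2))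
  have hb := Primrec.fst.comp (Primrec.snd.comp (Primrec.snd.comp (Primrec.snd.comp h2)))
  exact Primrec.ite (primrecPred_forcesFrom Primrec.fst hτ hm hn hb)
    (Primrec.option_some.comp (hτ.pair (hn.pair hb))) (Primrec.const none)

end Computability

namespace TuringFunctional

variable (Φ : TuringFunctional)

/-- The list of the axioms of `Φ` with index below `s`. -/
def stage (s : ℕ) : List (FinInfo × ℕ × Bool) :=
  Nat.rec [] (fun k l => l ++ (Φ.axs k).toList) s

theorem mem_stage {s : ℕ} {a : FinInfo × ℕ × Bool} :
    a ∈ Φ.stage s ↔ ∃ k < s, Φ.axs k = some a := by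
  induction s with
  | zero => simp [stage]
  | succ s ih =>
    have hs : Φ.stage (s + 1) = Φ.stage s ++ (Φ.axs s).toList := rfl
    rw [hs, List.mem_append, ih, Option.mem_toList]
    constructor
    · rintro (⟨k, hk, h⟩ | h)
      · exact ⟨k, by omega, h⟩
      · exact ⟨s, by omega, h⟩
    · rintro ⟨k, hk, h⟩
      rcases Nat.lt_succ_iff_lt_or_eq.1 hk with hk | rfl
      · exact Or.inl ⟨k, hk, h⟩
      · exact Or.inr h

theorem computable_stage : Computable Φ.stage := by
  have h : Computable₂ fun (_ : ℕ) (x : ℕ × List (FinInfo × ℕ × Bool)) =>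
      x.2 ++ (Φ.axs x.1).toList :=
    Computable.list_append.comp (Computable.snd.comp Computable.snd)
      (Primrec.optionToList.to_comp.comp
        (Φ.axs_computable.comp (Computable.fst.comp Computable.snd)))
  exact Computable.nat_rec (f := fun s : ℕ => s) (g := fun _ => []) Computable.id
    (Computable.const []) h

variable {Φ}

theorem HaltsT.unique {C : Set ℕ} {n : ℕ} {b₁ b₂ : Bool} (h₁ : Φ.HaltsT C n b₁)
    (h₂ : Φ.HaltsT C n b₂) : b₁ = b₂ := by
  obtain ⟨k₁, σ₁, e₁, a₁⟩ := h₁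
  obtain ⟨k₂, σ₂, e₂, a₂⟩ := h₂
  refine Φ.consistent _ _ _ _ _ _ _ e₁ e₂ fun p hp q hq hpq => ?_
  rw [Bool.eq_iff_iff, a₁ p hp, a₂ q hq, hpq]

theorem haltsT_of_outputFrom {C : Set ℕ} {s m n : ℕ} {r : List ℕ} {τ : FinInfo} {b : Bool}
    (hτ : AgreesSet τ C) (h : OutputFrom (Φ.stage s) m r τ n b) :
    Φ.HaltsT (modifyBelow C m r) n b := by
  obtain ⟨⟨σ, n', b'⟩, ha, e, hσ⟩ := h
  obtain ⟨rfl, rfl⟩ := Prod.mk.inj e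
  obtain ⟨k, -, hk⟩ := Φ.mem_stage.1 ha
  refine ⟨k, σ, hk, fun p hp => ?_⟩
  rcases hσ p hp with ⟨hm, h⟩ | ⟨hm, h⟩
  · simp [modifyBelow, h, hm, not_le.2 hm]
  · simp [modifyBelow, hτ p h, hm, not_lt.2 hm]

theorem haltsT_of_forcesFrom {C : Set ℕ} {s m n : ℕ} {τ : FinInfo} {b : Bool}
    (hτ : AgreesSet τ C) (h : ForcesFrom (Φ.stage s) τ m n b) : Φ.HaltsT C n b := by
  obtain ⟨r, hr, hrC⟩ := exists_mem_subsetLists C m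
  have := haltsT_of_outputFrom hτ (h.2.2.1 r hr)
  rwa [modifyBelow_eq_self hrC] at this

open Classical in
/-- The record of the answers of `C` to the queries in `[m, s)`. -/
noncomputable def restrictIco (C : Set ℕ) (m s : ℕ) : FinInfo :=
  ((List.range s).filter (m ≤ ·)).map fun x => (x, decide (x ∈ C))

theorem mem_restrictIco {C : Set ℕ} {m s : ℕ} {p : ℕ × Bool} :
    p ∈ restrictIco C m s ↔ p.1 < s ∧ m ≤ p.1 ∧ (p.2 = true ↔ p.1 ∈ C) := by
  classical
  obtain ⟨x, b⟩ := p
  simp only [restrictIco, List.mem_map, List.mem_filter, List.mem_range, decide_eq_true_eq,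
    Prod.mk.injEq]
  constructor
  · rintro ⟨y, ⟨h1, h2⟩, rfl, rfl⟩
    exact ⟨h1, h2, by simp⟩
  · rintro ⟨h1, h2, h3⟩
    exact ⟨x, ⟨h1, h2⟩, rfl, by rw [Bool.eq_iff_iff, h3]; simp⟩

theorem eventually_outputFrom {C : Set ℕ} {m m' n : ℕ} {r : List ℕ} {b : Bool} (hm : m' ≤ m)
    (h : Φ.HaltsT (modifyBelow C m r) n b) :
    ∀ᶠ s in atTop, OutputFrom (Φ.stage s) m r (restrictIco C m' s) n b := by
  obtain ⟨k, σ, hk, hσ⟩ := h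
  have hb : ∀ᶠ s in atTop, ∀ p ∈ σ, p.1 < s := by
    have := (Filter.eventually_all_finset (l := atTop) (p := fun (p : ℕ × Bool) s => p.1 < s)
      σ.toFinset).2 fun p _ => eventually_gt_atTop p.1
    simpa only [List.mem_toFinset] using this
  filter_upwards [hb, eventually_gt_atTop k] with s hs hks
  refine ⟨(σ, n, b), Φ.mem_stage.2 ⟨k, hks, hk⟩, rfl, fun p hp => ?_⟩
  have := hσ p hp
  rcases lt_or_ge p.1 m with hpm | hpm
  · exact Or.inl ⟨hpm, by simpa [modifyBelow, hpm, not_le.2 hpm] using this⟩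
  · refine Or.inr ⟨hpm, mem_restrictIco.2 ⟨hs p hp, hm.trans hpm, ?_⟩⟩
    simpa [modifyBelow, hpm, not_lt.2 hpm] using this

variable (Φ)

/-- The functional that on input `n` finds, going down from `n`, the first `m` such that `Φ`
gives the same output on `n` for all modifications of the oracle below `m`. -/
noncomputable def delayed : TuringFunctional where
  axs k := (Encodable.decode (α := FinInfo × ℕ × ℕ × Bool × ℕ) k).bind fun t =>
    forcedAxiom (Φ.stage t.2.2.2.2) t
  axs_computable := by
    have hs : Computable fun x : ℕ × (FinInfo × ℕ × ℕ × Bool × ℕ) => x.2.2.2.2.2 :=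
      Computable.snd.comp (Computable.snd.comp (Computable.snd.comp
        (Computable.snd.comp Computable.snd)))
    have h : Computable₂ fun (_ : ℕ) (t : FinInfo × ℕ × ℕ × Bool × ℕ) =>
        forcedAxiom (Φ.stage t.2.2.2.2) t :=
      primrec_forcedAxiom.to_comp.comp (Φ.computable_stage.comp hs) Computable.snd
    exact Computable.option_bind Computable.decode h
  consistent := by
    intro k₁ k₂ σ₁ σ₂ n b₁ b₂ h₁ h₂ hσ
    obtain ⟨t₁, -, h₁⟩ := Option.bind_eq_some_iff.1 h₁
    obtain ⟨t₂, -, h₂⟩ := Option.bind_eq_some_iff.1 h₂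
    have f₁ := (forcedAxiom_eq_some.1 h₁).1
    have f₂ := (forcedAxiom_eq_some.1 h₂).1
    let C : Set ℕ := {x | (x, true) ∈ σ₁ ∨ (x, true) ∈ σ₂}
    have a₁ : AgreesSet σ₁ C := by
      rintro ⟨x, b⟩ hp
      constructor
      · rintro rfl
        exact Or.inl hp
      · rintro (h | h)
        · exact f₁.2.1 _ hp _ h rfl
        · exact hσ _ hp _ h rfl
    have a₂ : AgreesSet σ₂ C := by
      rintro ⟨x, b⟩ hp
      constructor
      · rintro rfl
        exact Or.inr hp
      · rintro (h | h)
        · exact (hσ _ h _ hp rfl).symm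
        · exact f₂.2.1 _ hp _ h rfl
    exact (haltsT_of_forcesFrom a₁ f₁).unique (haltsT_of_forcesFrom a₂ f₂)

theorem exists_delayed_axs_iff {σ : FinInfo} {n : ℕ} {b : Bool} :
    (∃ k, Φ.delayed.axs k = some (σ, n, b)) ↔ ∃ m s, ForcesFrom (Φ.stage s) σ m n b := by
  constructor
  · rintro ⟨k, h⟩
    obtain ⟨t, -, h⟩ := Option.bind_eq_some_iff.1 h
    exact ⟨_, _, (forcedAxiom_eq_some.1 h).1⟩
  · rintro ⟨m, s, f⟩
    refine ⟨Encodable.encode (σ, m, n, b, s), Option.bind_eq_some_iff.2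
      ⟨_, Encodable.encodek _, forcedAxiom_eq_some.2 ⟨f, rfl, rfl, rfl⟩⟩⟩

variable {Φ}

theorem totalOn_delayed {A : Set ℕ} (h : ∀ m r, Φ.TotalOn (modifyBelow A m r)) :
    Φ.delayed.TotalOn A := by
  classical
  intro n
  let P : ℕ → Prop := fun m => ∃ b, ∀ r ∈ subsetLists m, Φ.HaltsT (modifyBelow A m r) n b
  have h0 : P 0 := by
    obtain ⟨b, hb⟩ := h 0 [] n
    exact ⟨b, fun r hr => by simpa [show r = [] by simpa [subsetLists] using hr] using hb⟩
  obtain ⟨m, hm⟩ : ∃ m, m = Nat.findGreatest P n := ⟨_, rfl⟩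
  obtain ⟨b, hb⟩ : P m := hm ▸ Nat.findGreatest_spec (Nat.zero_le n) h0
  have hsplit : m = n ∨ ((∃ r ∈ subsetLists (m + 1), Φ.HaltsT (modifyBelow A (m + 1) r) n true) ∧
      (∃ r ∈ subsetLists (m + 1), Φ.HaltsT (modifyBelow A (m + 1) r) n false)) := by
    refine or_iff_not_imp_left.2 fun hne => ?_
    have hle : m ≤ n := hm ▸ Nat.findGreatest_le n
    have hP : ¬ P (m + 1) := Nat.findGreatest_is_greatest (n := n) (by omega) (by omega)
    have other (c : Bool) :
        ∃ r ∈ subsetLists (m + 1), Φ.HaltsT (modifyBelow A (m + 1) r) n (!c) := by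
      by_contra! hc
      refine hP ⟨c, fun r hr => ?_⟩
      obtain ⟨d, hd⟩ := h (m + 1) r n
      by_cases hdc : d = c
      · exact hdc ▸ hd
      · exact absurd (Bool.eq_not_of_ne hdc ▸ hd) (hc r hr)
    exact ⟨other false, other true⟩
  have e₁ : ∀ᶠ s in atTop, ∀ r ∈ subsetLists m,
      OutputFrom (Φ.stage s) m r (restrictIco A m s) n b := by
    have := (Filter.eventually_all_finset (l := atTop)
      (p := fun r s => OutputFrom (Φ.stage s) m r (restrictIco A m s) n b)
      (subsetLists m).toFinset).2
      fun r hr => eventually_outputFrom le_rfl (hb r (List.mem_toFinset.1 hr))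
    simpa only [List.mem_toFinset] using this
  have e₂ : ∀ᶠ s in atTop, m = n ∨
      ((∃ r ∈ subsetLists (m + 1),
        OutputFrom (Φ.stage s) (m + 1) r (restrictIco A m s) n true) ∧
      (∃ r ∈ subsetLists (m + 1),
        OutputFrom (Φ.stage s) (m + 1) r (restrictIco A m s) n false)) := by
    rcases hsplit with hmn | ⟨⟨r₁, hr₁, h₁⟩, ⟨r₂, hr₂, h₂⟩⟩
    · exact Eventually.of_forall fun _ => Or.inl hmn
    · filter_upwards [eventually_outputFrom (Nat.le_succ m) h₁,
        eventually_outputFrom (Nat.le_succ m) h₂] with s g₁ g₂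
      exact Or.inr ⟨⟨r₁, hr₁, g₁⟩, ⟨r₂, hr₂, g₂⟩⟩
  obtain ⟨s, g₁, g₂⟩ := (e₁.and e₂).exists
  have f : ForcesFrom (Φ.stage s) (restrictIco A m s) m n b := by
    refine ⟨fun p hp => (mem_restrictIco.1 hp).2.1, fun p hp q hq hpq => ?_, g₁, g₂⟩
    rw [Bool.eq_iff_iff, (mem_restrictIco.1 hp).2.2, (mem_restrictIco.1 hq).2.2, hpq]
  obtain ⟨k, hk⟩ := Φ.exists_delayed_axs_iff.2 ⟨m, s, f⟩
  exact ⟨b, k, _, hk, fun p hp => (mem_restrictIco.1 hp).2.2⟩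

theorem HaltsT.of_delayed {C : Set ℕ} {n : ℕ} {b : Bool} (h : Φ.delayed.HaltsT C n b) :
    Φ.HaltsT C n b := by
  obtain ⟨k, σ, hk, hσ⟩ := h
  obtain ⟨m, s, f⟩ := Φ.exists_delayed_axs_iff.1 ⟨k, hk⟩
  exact haltsT_of_forcesFrom hσ f

theorem eventually_not_queriesAt_delayed {A B : Set ℕ}
    (h : ∀ m r, (Φ.AgreeSet (modifyBelow A m r) B)ᶜ.Finite) (m : ℕ) :
    ∀ᶠ n in atTop, ¬ Φ.delayed.QueriesAt A n m := by
  classical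
  have hev : ∀ᶠ n in atTop, ∀ j ∈ Finset.range (m + 2), ∀ r ∈ (subsetLists j).toFinset,
      n ∈ Φ.AgreeSet (modifyBelow A j r) B := by
    refine (Filter.eventually_all_finset _).2 fun j _ => (Filter.eventually_all_finset _).2
      fun r _ => ?_
    have := (h j r).compl_mem_cofinite
    rwa [compl_compl, Nat.cofinite_eq_atTop] at this
  filter_upwards [hev, eventually_gt_atTop m] with n hn hmn
  rintro ⟨k, σ, b, hk, hσ, -, p, hp, hpm⟩
  obtain ⟨m', s, f⟩ := Φ.exists_delayed_axs_iff.1 ⟨k, hk⟩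
  have hm' : m' ≤ m := hpm ▸ f.1 p hp
  obtain hf | ⟨⟨r₁, hr₁, g₁⟩, ⟨r₂, hr₂, g₂⟩⟩ := f.2.2.2
  · omega
  have correct {r : List ℕ} {c : Bool} (hr : r ∈ subsetLists (m' + 1))
      (g : OutputFrom (Φ.stage s) (m' + 1) r σ n c) : c = true ↔ n ∈ B := by
    obtain ⟨d, hd, hdB⟩ := hn (m' + 1) (Finset.mem_range.2 (by omega)) r (List.mem_toFinset.2 hr)
    rwa [(haltsT_of_outputFrom hσ g).unique hd]
  exact absurd ((correct hr₂ g₂).2 ((correct hr₁ g₁).1 rfl)) (by simp)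

end TuringFunctional

theorem mod_finite_red_implies_ubfb_red (A B : Set ℕ) (h : ModFinRed B A) :
    UbfbRed B A := by
  obtain ⟨Φ, hΦ, hmod⟩ := h
  have hC (m : ℕ) (r : List ℕ) := hmod _ (finite_modifyBelow_diff A m r)
  exact ⟨Φ.delayed, ⟨TuringFunctional.totalOn_delayed fun m r => (hC m r).1,
    fun n b hb => hΦ.2 n b hb.of_delayed⟩,
    TuringFunctional.eventually_not_queriesAt_delayed fun m r => (hC m r).2⟩
end

section
/- For all sets A, B ⊆ ℕ: B is cofinitely reducible to A if and only if R̃(B) is generically reducible to R̃(A). Hence the map S ↦ R̃(S) induces an embedding of the cofinite degrees into the generic degrees. -/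
open Filter

open Classical in
/-- The characteristic function of `A`, as a partial oracle with full domain. -/
noncomputable def totalOracle (A : Set ℕ) : ℕ →. Bool := fun n => Part.some (decide (n ∈ A))

theorem mem_totalOracle {A : Set ℕ} {n : ℕ} {b : Bool} :
    b ∈ totalOracle A n ↔ (b = true ↔ n ∈ A) := by
  by_cases h : n ∈ A <;> cases b <;> simp [totalOracle, h]

theorem agreesPart_totalOracle {σ : FinInfo} {A : Set ℕ} :
    AgreesPart σ (totalOracle A) ↔ AgreesSet σ A :=
  forall₂_congr fun _ _ => mem_totalOracle

theorem AgreesPart.compatible {σ τ : FinInfo} {g : ℕ →. Bool} (hσ : AgreesPart σ g)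
    (hτ : AgreesPart τ g) : σ.Compatible τ := by
  intro p hp q hq h
  have h₁ := hσ p hp
  rw [h] at h₁
  exact Part.mem_unique h₁ (hτ q hq)

theorem AgreesPart.agreesSet {σ : FinInfo} {g : ℕ →. Bool} {A : Set ℕ}
    (hg : IsPartialOracle g A) (h : AgreesPart σ g) : AgreesSet σ A :=
  fun p hp => hg _ _ (h p hp)

namespace TuringFunctional

theorem haltsP_totalOracle {Φ : TuringFunctional} {A : Set ℕ} {n : ℕ} {b : Bool} :
    Φ.HaltsP (totalOracle A) n b ↔ Φ.HaltsT A n b := by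
  simp only [HaltsP, HaltsT, agreesPart_totalOracle]

theorem HaltsP.unique {Φ : TuringFunctional} {g : ℕ →. Bool} {n : ℕ} {b c : Bool}
    (hb : Φ.HaltsP g n b) (hc : Φ.HaltsP g n c) : b = c := by
  obtain ⟨k, σ, hk, hσ⟩ := hb
  obtain ⟨l, τ, hl, hτ⟩ := hc
  exact Φ.consistent _ _ _ _ _ _ _ hk hl (hσ.compatible hτ)

/-- The partial function `Φ^g`. -/
noncomputable def eval (Φ : TuringFunctional) (g : ℕ →. Bool) : ℕ →. Bool :=
  fun n => ⟨∃ b, Φ.HaltsP g n b, fun h => h.choose⟩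

theorem mem_eval {Φ : TuringFunctional} {g : ℕ →. Bool} {n : ℕ} {b : Bool} :
    b ∈ Φ.eval g n ↔ Φ.HaltsP g n b := by
  constructor
  · rintro ⟨h, rfl⟩
    exact h.choose_spec
  · intro h
    exact ⟨⟨b, h⟩, (Exists.choose_spec (⟨b, h⟩ : ∃ b, Φ.HaltsP g n b)).unique h⟩

theorem pDom_eval (Φ : TuringFunctional) (g : ℕ →. Bool) : pDom (Φ.eval g) = Φ.PDomain g :=
  rfl

theorem isPartialOracle_eval {Φ : TuringFunctional} {g : ℕ →. Bool} {B : Set ℕ} :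
    IsPartialOracle (Φ.eval g) B ↔ Φ.PAgrees g B := by
  simp only [IsPartialOracle, PAgrees, mem_eval]

theorem funEq_iff_eval {Φ : TuringFunctional} {A B : Set ℕ} :
    Φ.FunEq A B ↔ Φ.eval (totalOracle A) = totalOracle B := by
  constructor
  · rintro ⟨htot, hcor⟩
    ext n b
    rw [mem_eval, haltsP_totalOracle, mem_totalOracle]
    refine ⟨hcor n b, fun h => ?_⟩
    obtain ⟨c, hc⟩ := htot n
    have := (hcor n c hc).trans h.symm
    rwa [Bool.eq_iff_iff.2 this] at hc
  · intro h
    have key : ∀ n b, Φ.HaltsT A n b ↔ (b = true ↔ n ∈ B) := by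
      intro n b
      rw [← haltsP_totalOracle, ← mem_eval, h, mem_totalOracle]
    refine ⟨fun n => ?_, fun n b => (key n b).1⟩
    classical exact ⟨decide (n ∈ B), (key _ _).2 (by simp)⟩

theorem FunEq.pAgrees {Φ : TuringFunctional} {A B : Set ℕ} {g : ℕ →. Bool}
    (h : Φ.FunEq A B) (hg : IsPartialOracle g A) : Φ.PAgrees g B := by
  rintro n b ⟨k, σ, hk, hσ⟩
  exact h.2 n b ⟨k, σ, hk, hσ.agreesSet hg⟩

theorem FunEq.isPartialOracle {Φ : TuringFunctional} {A B : Set ℕ} {g : ℕ →. Bool}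
    (h : Φ.FunEq A B) (hg : IsPartialOracle g A) : IsPartialOracle (Φ.eval g) B :=
  isPartialOracle_eval.2 (h.pAgrees hg)

/-! ### Composition of functionals -/

/-- The axioms of `Φ` enumerated before stage `s`. -/
def axsBefore (Φ : TuringFunctional) (s : ℕ) : List (FinInfo × ℕ × Bool) :=
  Nat.rec [] (fun k l => ((Φ.axs k).map (· :: l)).getD l) s

theorem mem_axsBefore {Φ : TuringFunctional} {s : ℕ} {a : FinInfo × ℕ × Bool} :
    a ∈ Φ.axsBefore s ↔ ∃ k < s, Φ.axs k = some a := by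
  induction s with
  | zero => simp [axsBefore]
  | succ s ih =>
    have : Φ.axsBefore (s + 1) = ((Φ.axs s).map (· :: Φ.axsBefore s)).getD (Φ.axsBefore s) := rfl
    rw [this]
    simp only [Nat.lt_succ_iff_lt_or_eq, or_and_right, exists_or, exists_eq_left, ← ih]
    cases Φ.axs s <;> simp [or_comm, eq_comm]

theorem computable_axsBefore (Φ : TuringFunctional) : Computable Φ.axsBefore := by
  have step : Computable₂ fun (_ : ℕ) (c : ℕ × List (FinInfo × ℕ × Bool)) =>
      ((Φ.axs c.1).map (· :: c.2)).getD c.2 := by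
    refine Computable.option_getD (Computable.option_map
      (g := fun (p : ℕ × ℕ × List (FinInfo × ℕ × Bool)) a => a :: p.2.2)
      (Φ.axs_computable.comp (Computable.fst.comp Computable.snd)) ?_)
      (Computable.snd.comp Computable.snd)
    exact Computable.list_cons.comp Computable.snd
      (Computable.snd.comp (Computable.snd.comp Computable.fst))
  exact Computable.nat_rec Computable.id (Computable.const []) step

/-- Every query recorded in `σ` is answered by an axiom from `L` which only uses
queries recorded in `τ`. -/
def Covers (L : List (FinInfo × ℕ × Bool)) (τ σ : FinInfo) : Prop :=
  ∀ p ∈ σ, ∃ a ∈ L, a.2 = p ∧ a.1 ⊆ τ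

theorem primrecRel_mem_list {α : Type*} [Primcodable α] :
    PrimrecRel fun (a : α) (l : List α) => a ∈ l :=
  ((Primrec.eq (α := α)).exists_mem_list.swap).of_eq fun a l => by simp [Function.swap]

theorem primrecRel_list_subset {α : Type*} [Primcodable α] :
    PrimrecRel fun (l m : List α) => l ⊆ m :=
  primrecRel_mem_list.forall_mem_list.of_eq fun _ _ => Iff.rfl

theorem primrecRel_covers :
    PrimrecRel fun (σ : FinInfo) (c : List (FinInfo × ℕ × Bool) × FinInfo) =>
      Covers c.1 c.2 σ := by
  have answers : PrimrecRel fun (a : FinInfo × ℕ × Bool) (c : (ℕ × Bool) × FinInfo) =>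
      a.2 = c.1 ∧ a.1 ⊆ c.2 :=
    (Primrec.eq.comp (Primrec.snd.comp Primrec.fst) (Primrec.fst.comp Primrec.snd)).and
      (primrecRel_list_subset.comp (Primrec.fst.comp Primrec.fst) (Primrec.snd.comp Primrec.snd))
  have answered : PrimrecRel fun (p : ℕ × Bool) (c : List (FinInfo × ℕ × Bool) × FinInfo) =>
      ∃ a ∈ c.1, a.2 = p ∧ a.1 ⊆ c.2 :=
    answers.exists_mem_list.comp (Primrec.fst.comp Primrec.snd)
      (Primrec.fst.pair (Primrec.snd.comp Primrec.snd))
  exact answered.forall_mem_list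

open Classical in
/-- Replaces the queries of `a` by those recorded in `c.2`, provided that these cover them. -/
noncomputable def reroute (a : FinInfo × ℕ × Bool) (c : List (FinInfo × ℕ × Bool) × FinInfo) :
    Option (FinInfo × ℕ × Bool) :=
  if Covers c.1 c.2 a.1 then some (c.2, a.2) else none

theorem reroute_eq_some {a o : FinInfo × ℕ × Bool} {c : List (FinInfo × ℕ × Bool) × FinInfo} :
    reroute a c = some o ↔ Covers c.1 c.2 a.1 ∧ (c.2, a.2) = o := by
  simp [reroute]

open Classical in
theorem primrec₂_reroute : Primrec₂ reroute :=
  Primrec.ite (primrecRel_covers.comp (Primrec.fst.comp Primrec.fst) Primrec.snd)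
    (Primrec.option_some.comp ((Primrec.snd.comp Primrec.snd).pair
      (Primrec.snd.comp Primrec.fst)))
    (Primrec.const none)

/-- The composition of two functionals: `(Ψ.comp Φ)^g = Ψ^(Φ^g)`. -/
noncomputable def comp (Ψ Φ : TuringFunctional) : TuringFunctional where
  axs j := (Encodable.decode (α := ℕ × ℕ × FinInfo) j).bind fun t =>
    (Ψ.axs t.2.1).bind fun a => reroute a (Φ.axsBefore t.1, t.2.2)
  axs_computable := by
    have ht : Computable fun c : (ℕ × ℕ × ℕ × FinInfo) × FinInfo × ℕ × Bool => c.1.2 :=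
      Computable.snd.comp Computable.fst
    have inner : Computable₂ fun (c : ℕ × ℕ × ℕ × FinInfo) (a : FinInfo × ℕ × Bool) =>
        reroute a (Φ.axsBefore c.2.1, c.2.2.2) :=
      primrec₂_reroute.to_comp.comp Computable.snd
        ((Φ.computable_axsBefore.comp (Computable.fst.comp ht)).pair
          (Computable.snd.comp (Computable.snd.comp ht)))
    have outer : Computable₂ fun (_ : ℕ) (t : ℕ × ℕ × FinInfo) =>
        (Ψ.axs t.2.1).bind fun a => reroute a (Φ.axsBefore t.1, t.2.2) :=
      Computable.option_bind
        (Ψ.axs_computable.comp (Computable.fst.comp (Computable.snd.comp Computable.snd))) inner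
    exact Computable.option_bind Computable.decode outer
  consistent := by
    intro j₁ j₂ τ₁ τ₂ n b₁ b₂ h₁ h₂ hτ
    simp only [Option.bind_eq_some_iff, reroute_eq_some] at h₁ h₂
    obtain ⟨⟨s₁, k₁, _⟩, -, ⟨σ₁, _⟩, hk₁, hc₁, h₁⟩ := h₁
    obtain ⟨⟨s₂, k₂, _⟩, -, ⟨σ₂, _⟩, hk₂, hc₂, h₂⟩ := h₂
    simp only [Prod.mk.injEq] at h₁ h₂
    obtain ⟨rfl, rfl⟩ := h₁
    obtain ⟨rfl, rfl⟩ := h₂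
    refine Ψ.consistent _ _ _ _ _ _ _ hk₁ hk₂ ?_
    rintro ⟨m, c⟩ hp ⟨m', d⟩ hq (rfl : m = m')
    obtain ⟨⟨ρ₁, _⟩, ha₁, rfl, hρ₁⟩ := hc₁ _ hp
    obtain ⟨⟨ρ₂, _⟩, ha₂, rfl, hρ₂⟩ := hc₂ _ hq
    obtain ⟨l₁, -, hl₁⟩ := mem_axsBefore.1 ha₁
    obtain ⟨l₂, -, hl₂⟩ := mem_axsBefore.1 ha₂
    exact Φ.consistent _ _ _ _ _ _ _ hl₁ hl₂
      fun p hp q hq => hτ p (hρ₁ hp) q (hρ₂ hq)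

theorem exists_covers {Φ : TuringFunctional} {g : ℕ →. Bool} {σ : FinInfo}
    (h : AgreesPart σ (Φ.eval g)) :
    ∃ s τ, AgreesPart τ g ∧ Covers (Φ.axsBefore s) τ σ := by
  induction σ with
  | nil => exact ⟨0, [], by simp [AgreesPart], by simp [Covers]⟩
  | cons p σ ih =>
    obtain ⟨s, τ, hτ, hc⟩ := ih fun q hq => h q (List.mem_cons_of_mem _ hq)
    obtain ⟨k, ρ, hk, hρ⟩ := mem_eval.1 (h p List.mem_cons_self)
    refine ⟨max s (k + 1), ρ ++ τ, ?_, ?_⟩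
    · intro q hq
      exact (List.mem_append.1 hq).elim (hρ q) (hτ q)
    · intro q hq
      rcases List.mem_cons.1 hq with rfl | hq
      · exact ⟨(ρ, q), mem_axsBefore.2 ⟨k, by omega, hk⟩, rfl, List.subset_append_left _ _⟩
      · obtain ⟨a, ha, haq, hsub⟩ := hc q hq
        obtain ⟨l, hl, hla⟩ := mem_axsBefore.1 ha
        exact ⟨a, mem_axsBefore.2 ⟨l, by omega, hla⟩, haq,
          List.subset_append_of_subset_right _ hsub⟩

theorem Covers.agreesPart {Φ : TuringFunctional} {g : ℕ →. Bool} {s : ℕ} {σ τ : FinInfo}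
    (hc : Covers (Φ.axsBefore s) τ σ) (hτ : AgreesPart τ g) : AgreesPart σ (Φ.eval g) := by
  intro p hp
  obtain ⟨⟨ρ, _⟩, ha, rfl, hρ⟩ := hc p hp
  obtain ⟨l, -, hl⟩ := mem_axsBefore.1 ha
  exact mem_eval.2 ⟨l, ρ, hl, fun q hq => hτ q (hρ hq)⟩

theorem eval_comp (Ψ Φ : TuringFunctional) (g : ℕ →. Bool) :
    (Ψ.comp Φ).eval g = Ψ.eval (Φ.eval g) := by
  ext n b
  simp only [mem_eval]
  constructor
  · rintro ⟨j, τ, hj, hτ⟩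
    simp only [comp, Option.bind_eq_some_iff, reroute_eq_some] at hj
    obtain ⟨⟨s, k, _⟩, -, ⟨σ, _⟩, hk, hc, hj⟩ := hj
    simp only [Prod.mk.injEq] at hj
    obtain ⟨rfl, rfl⟩ := hj
    exact ⟨k, σ, hk, hc.agreesPart hτ⟩
  · rintro ⟨k, σ, hk, hσ⟩
    obtain ⟨s, τ, hτ, hc⟩ := exists_covers hσ
    refine ⟨Encodable.encode (s, k, τ), τ, ?_, hτ⟩
    simp [comp, hk, reroute_eq_some, hc]

theorem FunEq.comp {Ψ Φ : TuringFunctional} {A B C : Set ℕ} (hΨ : Ψ.FunEq B C)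
    (hΦ : Φ.FunEq A B) : (Ψ.comp Φ).FunEq A C := by
  rw [funEq_iff_eval] at *
  rw [eval_comp, hΦ, hΨ]

end TuringFunctional

/-! ### The block functional and the majority functional -/

theorem mem_Rtilde_of_mem_Ico {S : Set ℕ} {n x : ℕ} (hx : x ∈ Set.Ico (2 ^ n) (2 ^ (n + 1))) :
    x ∈ Rtilde S ↔ n ∈ S := by
  constructor
  · rintro ⟨k, hk, m, hm, rfl⟩
    have h₁ : Nat.log 2 (2 ^ k + m) = k :=
      Nat.log_eq_of_pow_le_of_lt_pow (by omega) (by rw [pow_succ]; omega)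
    have h₂ : Nat.log 2 (2 ^ k + m) = n := Nat.log_eq_of_pow_le_of_lt_pow hx.1 hx.2
    rwa [← h₂, h₁]
  · intro hn
    obtain ⟨h₁, h₂⟩ := hx
    rw [pow_succ] at h₂
    exact ⟨n, hn, x - 2 ^ n, by omega, by omega⟩

theorem zero_notMem_Rtilde (S : Set ℕ) : 0 ∉ Rtilde S := by
  rintro ⟨n, -, m, -, h⟩
  have := Nat.two_pow_pos n
  omega

theorem primrec₂_pow : Primrec₂ ((· ^ ·) : ℕ → ℕ → ℕ) :=
  Primrec₂.unpaired'.1 Nat.Primrec.pow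

theorem primrecRel_mem_Ico_two_pow :
    PrimrecRel fun x n : ℕ => x ∈ Set.Ico (2 ^ n) (2 ^ (n + 1)) :=
  (Primrec.nat_le.comp (primrec₂_pow.comp (Primrec.const 2) Primrec.snd) Primrec.fst).and
    (Primrec.nat_lt.comp Primrec.fst
      (primrec₂_pow.comp (Primrec.const 2) (Primrec.succ.comp Primrec.snd)))

namespace TuringFunctional

open Classical in
/-- The functional computing `R̃(S)` from `S`: it answers `x ∈ [2^n, 2^(n+1))` by querying
the oracle at `n`. -/
noncomputable def block : TuringFunctional where
  axs j := (Encodable.decode (α := ℕ × ℕ × Bool) j).bind fun t =>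
    if t.2.1 = 0 then some ([], 0, false)
    else if t.2.1 ∈ Set.Ico (2 ^ t.1) (2 ^ (t.1 + 1)) then some ([(t.1, t.2.2)], t.2) else none
  axs_computable := by
    have hn : Primrec fun c : ℕ × ℕ × ℕ × Bool => c.2.1 := Primrec.fst.comp Primrec.snd
    have hxb : Primrec fun c : ℕ × ℕ × ℕ × Bool => c.2.2 := Primrec.snd.comp Primrec.snd
    have hx := Primrec.fst.comp hxb
    have answer : Primrec₂ fun (_ : ℕ) (t : ℕ × ℕ × Bool) =>
        if t.2.1 = 0 then some (([] : FinInfo), 0, false)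
        else if t.2.1 ∈ Set.Ico (2 ^ t.1) (2 ^ (t.1 + 1)) then some ([(t.1, t.2.2)], t.2)
        else none :=
      Primrec.ite (Primrec.eq.comp hx (Primrec.const 0)) (Primrec.const _)
        (Primrec.ite (primrecRel_mem_Ico_two_pow.comp hx hn)
          (Primrec.option_some.comp ((Primrec.list_cons.comp (hn.pair (Primrec.snd.comp hxb))
            (Primrec.const [])).pair hxb))
          (Primrec.const none))
    exact (Primrec.option_bind Primrec.decode answer).to_comp
  consistent := by
    intro j₁ j₂ σ₁ σ₂ x b₁ b₂ h₁ h₂ hσ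
    simp only [Option.bind_eq_some_iff] at h₁ h₂
    obtain ⟨⟨n₁, x₁, c₁⟩, -, h₁⟩ := h₁
    obtain ⟨⟨n₂, x₂, c₂⟩, -, h₂⟩ := h₂
    dsimp only at h₁ h₂
    split_ifs at h₁ h₂ with hx₁ hx₂ hI₂ hI₁ hx₂ hI₂ <;>
      simp only [Option.some.injEq, Prod.mk.injEq] at h₁ h₂ <;>
      obtain ⟨rfl, hx₁', rfl⟩ := h₁ <;> obtain ⟨rfl, hx₂', rfl⟩ := h₂
    · rfl
    · omega
    · omega
    · obtain rfl := hx₁'.trans hx₂'.symm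
      have hn : n₁ = n₂ := by
        rw [← Nat.log_eq_of_pow_le_of_lt_pow hI₁.1 hI₁.2,
          ← Nat.log_eq_of_pow_le_of_lt_pow hI₂.1 hI₂.2]
      exact hσ (n₁, c₁) (by simp) (n₂, c₂) (by simp) hn

theorem haltsP_block_zero {g : ℕ →. Bool} {b : Bool} : block.HaltsP g 0 b ↔ b = false := by
  have h : block.HaltsP g 0 false :=
    ⟨Encodable.encode (0, 0, false), [], by simp [block], by simp [AgreesPart]⟩
  exact ⟨fun hb => hb.unique h, fun hb => hb ▸ h⟩

theorem haltsP_block {g : ℕ →. Bool} {n x : ℕ} {b : Bool}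
    (hx : x ∈ Set.Ico (2 ^ n) (2 ^ (n + 1))) : block.HaltsP g x b ↔ b ∈ g n := by
  have hx0 : x ≠ 0 := by
    have := Nat.two_pow_pos n
    have := hx.1
    omega
  constructor
  · rintro ⟨j, σ, hj, hσ⟩
    simp only [block, Option.bind_eq_some_iff] at hj
    obtain ⟨⟨m, y, c⟩, -, hj⟩ := hj
    dsimp only at hj
    split_ifs at hj with h₁ h₂ <;> simp only [Option.some.injEq, Prod.mk.injEq] at hj <;>
      obtain ⟨rfl, rfl, rfl⟩ := hj
    · exact absurd rfl hx0
    · have hn : m = n := by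
        rw [← Nat.log_eq_of_pow_le_of_lt_pow h₂.1 h₂.2,
          ← Nat.log_eq_of_pow_le_of_lt_pow hx.1 hx.2]
      exact hn ▸ hσ (m, c) (by simp)
  · intro hb
    refine ⟨Encodable.encode (n, x, b), [(n, b)], ?_, by simpa [AgreesPart] using hb⟩
    simp only [block, Encodable.encodek, Option.bind_some, if_neg hx0, if_pos hx]

end TuringFunctional

theorem exists_mem_Ico_two_pow {x : ℕ} (hx : x ≠ 0) :
    ∃ n, x ∈ Set.Ico (2 ^ n) (2 ^ (n + 1)) :=
  ⟨Nat.log 2 x, Nat.pow_log_le_self 2 hx, Nat.lt_pow_succ_log_self one_lt_two x⟩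

theorem funEq_block (A : Set ℕ) : TuringFunctional.block.FunEq A (Rtilde A) := by
  rw [TuringFunctional.funEq_iff_eval]
  ext x b
  rw [TuringFunctional.mem_eval, mem_totalOracle]
  rcases eq_or_ne x 0 with rfl | hx
  · simp [TuringFunctional.haltsP_block_zero, zero_notMem_Rtilde]
  · obtain ⟨n, hn⟩ := exists_mem_Ico_two_pow hx
    rw [TuringFunctional.haltsP_block hn, mem_totalOracle, mem_Rtilde_of_mem_Ico hn]

/-- More than half of the elements of `[2^n, 2^(n+1))` belong to `D`. -/
def Majority (n : ℕ) (D : Set ℕ) : Prop :=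
  2 ^ n < 2 * (D ∩ Set.Ico (2 ^ n) (2 ^ (n + 1))).ncard

theorem Majority.mono {n : ℕ} {D E : Set ℕ} (hD : Majority n D)
    (h : D ∩ Set.Ico (2 ^ n) (2 ^ (n + 1)) ⊆ E) : Majority n E := by
  have : (D ∩ Set.Ico (2 ^ n) (2 ^ (n + 1))).ncard ≤ (E ∩ Set.Ico (2 ^ n) (2 ^ (n + 1))).ncard :=
    Set.ncard_le_ncard (Set.subset_inter h Set.inter_subset_right)
      ((Set.finite_Ico _ _).inter_of_right _)
  unfold Majority at *
  omega

theorem majority_univ (n : ℕ) : Majority n Set.univ := by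
  have := Nat.two_pow_pos n
  simp only [Majority, Set.univ_inter, Set.ncard_Ico_nat, pow_succ]
  omega

theorem Majority.exists_mem {n : ℕ} {D E : Set ℕ} (hD : Majority n D) (hE : Majority n E) :
    ∃ x ∈ Set.Ico (2 ^ n) (2 ^ (n + 1)), x ∈ D ∧ x ∈ E := by
  by_contra! h
  have hdisj : Disjoint (D ∩ Set.Ico (2 ^ n) (2 ^ (n + 1)))
      (E ∩ Set.Ico (2 ^ n) (2 ^ (n + 1))) :=
    Set.disjoint_left.2 fun x hx hx' => h x hx.2 hx.1 hx'.1
  have hcard := Set.ncard_union_eq hdisj ((Set.finite_Ico _ _).inter_of_right _)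
    ((Set.finite_Ico _ _).inter_of_right _)
  have hle := Set.ncard_le_ncard (Set.union_subset
    (Set.inter_subset_right (s := D) (t := Set.Ico (2 ^ n) (2 ^ (n + 1))))
    (Set.inter_subset_right (s := E))) (Set.finite_Ico _ _)
  rw [Set.ncard_Ico_nat, pow_succ] at hle
  unfold Majority at hD hE
  rw [pow_succ] at hcard hD hE
  omega

theorem primrecPred_majority :
    PrimrecPred fun t : FinInfo × ℕ × Bool => Majority t.2.1 {x | (x, t.2.2) ∈ t.1} := by
  classical
  have hR : PrimrecRel fun (x : ℕ) (t : FinInfo × ℕ × Bool) =>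
      (x, t.2.2) ∈ t.1 ∧ x ∈ Set.Ico (2 ^ t.2.1) (2 ^ (t.2.1 + 1)) :=
    (TuringFunctional.primrecRel_mem_list.comp
      (Primrec.fst.pair (Primrec.snd.comp (Primrec.snd.comp Primrec.snd)))
      (Primrec.fst.comp Primrec.snd)).and
    (primrecRel_mem_Ico_two_pow.comp Primrec.fst
      (Primrec.fst.comp (Primrec.snd.comp Primrec.snd)))
  have hn : Primrec fun t : FinInfo × ℕ × Bool => t.2.1 := Primrec.fst.comp Primrec.snd
  have hlen := Primrec.list_length.comp (hR.listFilter.comp (Primrec.list_range.comp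
    (primrec₂_pow.comp (Primrec.const 2) (Primrec.succ.comp hn))) Primrec.id)
  refine (Primrec.nat_lt.comp (primrec₂_pow.comp (Primrec.const 2) hn)
    (Primrec.nat_mul.comp (Primrec.const 2) hlen)).of_eq fun t => ?_
  rw [Majority, ← List.toFinset_card_of_nodup (List.nodup_range.filter _),
    ← Set.ncard_coe_finset]
  congr! 3
  ext x
  simp only [List.coe_toFinset, List.mem_filter, List.mem_range, decide_eq_true_eq, id,
    Set.mem_ofPred_eq, Set.mem_inter_iff, Nat.succ_eq_add_one]
  exact ⟨fun h => h.2, fun h => ⟨h.2.2, h⟩⟩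

namespace TuringFunctional

open Classical in
/-- The functional computing `S` from `R̃(S)` which answers `b` at `n` as soon as more than half
of the elements of `[2^n, 2^(n+1))` are answered by `b`. -/
noncomputable def majority : TuringFunctional where
  axs j := (Encodable.decode (α := FinInfo × ℕ × Bool) j).bind fun t =>
    if Majority t.2.1 {x | (x, t.2.2) ∈ t.1} then some t else none
  axs_computable := by
    have answer : Primrec₂ fun (_ : ℕ) (t : FinInfo × ℕ × Bool) =>
        if Majority t.2.1 {x | (x, t.2.2) ∈ t.1} then some t else none :=
      Primrec.ite (primrecPred_majority.comp Primrec.snd) (Primrec.option_some.comp Primrec.snd)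
        (Primrec.const none)
    exact (Primrec.option_bind Primrec.decode answer).to_comp
  consistent := by
    intro j₁ j₂ σ₁ σ₂ n b₁ b₂ h₁ h₂ hσ
    simp only [Option.bind_eq_some_iff, Option.ite_none_right_eq_some, Option.some.injEq] at h₁ h₂
    obtain ⟨_, -, h₁, rfl⟩ := h₁
    obtain ⟨_, -, h₂, rfl⟩ := h₂
    obtain ⟨x, -, hx₁, hx₂⟩ := h₁.exists_mem h₂
    exact hσ _ hx₁ _ hx₂ rfl

theorem haltsP_majority {g : ℕ →. Bool} {n : ℕ} {b : Bool} :
    majority.HaltsP g n b ↔ Majority n {x | b ∈ g x} := by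
  constructor
  · rintro ⟨j, σ, hj, hσ⟩
    simp only [majority, Option.bind_eq_some_iff, Option.ite_none_right_eq_some,
      Option.some.injEq] at hj
    obtain ⟨_, -, h, rfl⟩ := hj
    exact h.mono fun x hx => hσ _ hx.1
  · intro h
    classical
    set σ : FinInfo :=
      ((List.range (2 ^ (n + 1))).filter fun x => b ∈ g x).map fun x => (x, b) with hσ
    refine ⟨Encodable.encode (σ, n, b), σ, ?_, ?_⟩
    · have : Majority n {x | (x, b) ∈ σ} := h.mono fun x hx => by
        simpa [hσ] using And.intro hx.2.2 hx.1
      simp only [majority, Encodable.encodek, Option.bind_some, if_pos this]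
    · intro p hp
      simp only [hσ, List.mem_map, List.mem_filter, decide_eq_true_eq] at hp
      obtain ⟨x, ⟨-, hx⟩, rfl⟩ := hp
      exact hx

end TuringFunctional

theorem funEq_majority (A : Set ℕ) : TuringFunctional.majority.FunEq (Rtilde A) A := by
  rw [TuringFunctional.funEq_iff_eval]
  ext n b
  rw [TuringFunctional.mem_eval, mem_totalOracle, TuringFunctional.haltsP_majority]
  constructor
  · intro h
    obtain ⟨x, hx, hxb, -⟩ := h.exists_mem h
    exact (mem_totalOracle.1 hxb).trans (mem_Rtilde_of_mem_Ico hx)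
  · intro h
    exact (majority_univ n).mono fun x hx =>
      mem_totalOracle.2 (h.trans (mem_Rtilde_of_mem_Ico hx.2).symm)

/-! ### Density -/

theorem densityOne_of_finite_compl {D : Set ℕ} (hD : Dᶜ.Finite) : DensityOne D := by
  have hlow : Tendsto (fun n : ℕ => 1 - (Dᶜ.ncard : ℝ) / n) atTop (nhds 1) := by
    simpa using (tendsto_const_div_atTop_nhds_zero_nat (Dᶜ.ncard : ℝ)).const_sub 1
  refine tendsto_of_tendsto_of_tendsto_of_le_of_le' hlow tendsto_const_nhds ?_ ?_
  · filter_upwards [eventually_gt_atTop 0] with n hn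
    have hn' : (0 : ℝ) < n := by exact_mod_cast hn
    have hcard : n ≤ (D ∩ Set.Iio n).ncard + Dᶜ.ncard := by
      calc n = (Set.Iio n).ncard := by simp
        _ ≤ ((D ∩ Set.Iio n) ∪ Dᶜ).ncard :=
          Set.ncard_le_ncard (fun x hx => by by_cases h : x ∈ D <;> simp_all)
            (((Set.finite_Iio n).inter_of_right D).union hD)
        _ ≤ _ := Set.ncard_union_le _ _
    have hcard' : (n : ℝ) ≤ (D ∩ Set.Iio n).ncard + Dᶜ.ncard := by exact_mod_cast hcard
    rw [sub_le_iff_le_add, ← add_div, le_div_iff₀ hn']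
    linarith
  · filter_upwards with n
    refine div_le_one_of_le₀ ?_ (Nat.cast_nonneg n)
    have := Set.ncard_le_ncard (Set.inter_subset_right (s := D)) (Set.finite_Iio n)
    simpa using this

theorem DensityOne.eventually_majority {D : Set ℕ} (hD : DensityOne D) :
    ∀ᶠ n in atTop, Majority n D := by
  have htwo : Tendsto (fun n : ℕ => 2 ^ (n + 1)) atTop atTop :=
    (tendsto_pow_atTop_atTop_of_one_lt one_lt_two).comp (tendsto_add_atTop_nat 1)
  filter_upwards [(hD.comp htwo).eventually (lt_mem_nhds (show (3 / 4 : ℝ) < 1 by norm_num))]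
    with n hn
  have hpos : (0 : ℝ) < ((2 ^ (n + 1) : ℕ) : ℝ) := by positivity
  rw [Function.comp_apply, lt_div_iff₀ hpos] at hn
  have hsub : D ∩ Set.Iio (2 ^ (n + 1)) ⊆
      Set.Iio (2 ^ n) ∪ (D ∩ Set.Ico (2 ^ n) (2 ^ (n + 1))) := by
    rintro x ⟨hx, hx'⟩
    rcases lt_or_ge x (2 ^ n) with h | h
    · exact Or.inl h
    · exact Or.inr ⟨hx, h, hx'⟩
  have hcard : (D ∩ Set.Iio (2 ^ (n + 1))).ncard ≤
      2 ^ n + (D ∩ Set.Ico (2 ^ n) (2 ^ (n + 1))).ncard := by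
    refine (Set.ncard_le_ncard hsub
      ((Set.finite_Iio _).union ((Set.finite_Ico _ _).inter_of_right D))).trans ?_
    refine (Set.ncard_union_le _ _).trans ?_
    simp
  have hcard' : ((D ∩ Set.Iio (2 ^ (n + 1))).ncard : ℝ) ≤
      2 ^ n + (D ∩ Set.Ico (2 ^ n) (2 ^ (n + 1))).ncard := by exact_mod_cast hcard
  have hcast : ((2 ^ (n + 1) : ℕ) : ℝ) = 2 * 2 ^ n := by push_cast; ring
  rw [hcast] at hn
  have : ((2 ^ n : ℕ) : ℝ) <
      ((2 * (D ∩ Set.Ico (2 ^ n) (2 ^ (n + 1))).ncard : ℕ) : ℝ) := by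
    push_cast
    linarith
  exact_mod_cast this

theorem densityOne_pDom_eval_block {g : ℕ →. Bool} (hg : (pDom g)ᶜ.Finite) :
    DensityOne (pDom (TuringFunctional.block.eval g)) := by
  refine densityOne_of_finite_compl ((hg.biUnion fun n _ =>
    Set.finite_Ico (2 ^ n) (2 ^ (n + 1))).subset fun x hx => ?_)
  rcases eq_or_ne x 0 with rfl | hx0
  · exact absurd ⟨false, TuringFunctional.haltsP_block_zero.2 rfl⟩ hx
  · obtain ⟨n, hn⟩ := exists_mem_Ico_two_pow hx0
    exact Set.mem_biUnion (fun hd => hx ⟨(g n).get hd,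
      (TuringFunctional.haltsP_block hn).2 (Part.get_mem hd)⟩) hn

theorem finite_compl_pDom_eval_majority {g : ℕ →. Bool} {A : Set ℕ}
    (hg : IsPartialOracle g (Rtilde A)) (hd : DensityOne (pDom g)) :
    (pDom (TuringFunctional.majority.eval g))ᶜ.Finite := by
  have hev : ∀ᶠ n in cofinite, n ∈ pDom (TuringFunctional.majority.eval g) := by
    rw [Nat.cofinite_eq_atTop]
    filter_upwards [hd.eventually_majority] with n hn
    classical
    refine ⟨decide (n ∈ A), TuringFunctional.haltsP_majority.2 (hn.mono ?_)⟩
    rintro x ⟨hx, hxn⟩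
    have hb := Part.get_mem hx
    have := (hg _ _ hb).trans (mem_Rtilde_of_mem_Ico hxn)
    rwa [Bool.eq_iff_iff.2 (this.trans (decide_eq_true_iff (p := n ∈ A)).symm)] at hb
  exact hev

theorem cofinite_red_iff_generic_red_Rtilde (A B : Set ℕ) :
    CofinRed B A ↔ GenericRed (Rtilde B) (Rtilde A) := by
  constructor
  · rintro ⟨Φ, hΦ, hdom⟩
    have hfun := (funEq_block B).comp (hΦ.comp (funEq_majority A))
    refine ⟨_, hfun, fun g hg hd => ⟨hfun.pAgrees hg, ?_⟩⟩
    rw [← TuringFunctional.pDom_eval, TuringFunctional.eval_comp, TuringFunctional.eval_comp]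
    exact densityOne_pDom_eval_block (hdom _ ((funEq_majority A).isPartialOracle hg)
      (finite_compl_pDom_eval_majority hg hd)).2
  · rintro ⟨Ψ, hΨ, hdom⟩
    have hfun := (funEq_majority B).comp (hΨ.comp (funEq_block A))
    refine ⟨_, hfun, fun g hg hd => ⟨hfun.pAgrees hg, ?_⟩⟩
    rw [← TuringFunctional.pDom_eval, TuringFunctional.eval_comp, TuringFunctional.eval_comp]
    have hg' := (funEq_block A).isPartialOracle hg
    exact finite_compl_pDom_eval_majority (hΨ.isPartialOracle hg')
      (hdom _ hg' (densityOne_pDom_eval_block hd)).2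
end

section
/- For all sets A, B ⊆ ℕ: B is Turing reducible to A if and only if R(B) is mod-finite reducible to R(A). Hence the map S ↦ R(S) induces an embedding of the Turing degrees into the mod-finite degrees. -/
open Filter

/-- The answer among `h 0, …, h (n - 1)` that is defined first, if there is one. -/
def firstSome {α : Type*} (h : ℕ → Option α) (n : ℕ) : Option α :=
  n.rec none fun t r => r <|> h t

theorem firstSome_succ {α : Type*} (h : ℕ → Option α) (n : ℕ) :
    firstSome h (n + 1) = (firstSome h n <|> h n) := rfl

theorem exists_eq_of_firstSome_eq_some {α : Type*} {h : ℕ → Option α} {n : ℕ} {b : α}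
    (hb : firstSome h n = some b) : ∃ t < n, h t = some b := by
  induction n with
  | zero => simp [firstSome] at hb
  | succ n ih =>
    rw [firstSome_succ] at hb
    cases hn : firstSome h n with
    | none => exact ⟨n, n.lt_succ_self, by simpa [hn] using hb⟩
    | some c =>
      obtain ⟨t, ht, htb⟩ := ih (by simpa [hn] using hb)
      exact ⟨t, by omega, htb⟩

theorem firstSome_mono {α : Type*} {h : ℕ → Option α} {n m : ℕ} (hnm : n ≤ m) {b : α}
    (hb : firstSome h n = some b) : firstSome h m = some b := by
  induction m, hnm using Nat.le_induction with
  | base => exact hb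
  | succ m _ ih => simp [firstSome_succ, ih]

theorem firstSome_congr {α : Type*} {h h' : ℕ → Option α} {n : ℕ}
    (hh : ∀ t < n, h t = h' t) : firstSome h n = firstSome h' n := by
  induction n with
  | zero => rfl
  | succ n ih =>
    rw [firstSome_succ, firstSome_succ, ih fun t ht => hh t (by omega), hh n n.lt_succ_self]

theorem exists_firstSome_succ_eq_some {α : Type*} {h : ℕ → Option α} {t : ℕ} {b : α}
    (hb : h t = some b) : ∃ b', firstSome h (t + 1) = some b' := by
  rw [firstSome_succ]
  cases firstSome h t <;> simp [hb]

theorem Computable.firstSome {α β : Type*} [Primcodable α] [Primcodable β]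
    {h : α → ℕ → Option β} {n : α → ℕ} (hh : Computable₂ h) (hn : Computable n) :
    Computable fun a => firstSome (h a) (n a) :=
  Computable.nat_rec (h := fun a p => p.2 <|> h a p.1) hn (Computable.const none)
    (Primrec.option_orElse.to_comp.comp (Computable.snd.comp Computable.snd)
      (hh.comp Computable.fst (Computable.fst.comp Computable.snd)))

/-- The record of the answers `l` to the queries `0, …, l.length - 1`. -/
def FinInfo.ofList (l : List Bool) : FinInfo :=
  (List.range l.length).map fun i => (i, l.getD i false)

theorem FinInfo.mem_ofList {l : List Bool} {p : ℕ × Bool} :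
    p ∈ FinInfo.ofList l ↔ l[p.1]? = some p.2 := by
  obtain ⟨i, b⟩ := p
  simp only [FinInfo.ofList, List.mem_map, List.mem_range, Prod.mk.injEq]
  constructor
  · rintro ⟨j, hj, rfl, rfl⟩
    simp [hj]
  · intro h
    obtain ⟨hi, hb⟩ := List.getElem?_eq_some_iff.1 h
    exact ⟨i, hi, rfl, by simp [hi, hb]⟩

theorem FinInfo.primrec_ofList : Primrec FinInfo.ofList :=
  Primrec.list_map (Primrec.list_range.comp Primrec.list_length)
    (Primrec.pair Primrec.snd ((Primrec.list_getD false).comp Primrec.fst Primrec.snd))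

open Classical in
/-- The list of the first `s` bits of the characteristic function of `C`. -/
noncomputable def initialBits (C : Set ℕ) (s : ℕ) : List Bool :=
  (List.range s).map fun i => decide (i ∈ C)

@[simp]
theorem length_initialBits (C : Set ℕ) (s : ℕ) : (initialBits C s).length = s := by
  simp [initialBits]

theorem initialBits_getElem?_eq_some {C : Set ℕ} {s i : ℕ} {b : Bool} :
    (initialBits C s)[i]? = some b ↔ i < s ∧ (b = true ↔ i ∈ C) := by
  by_cases hi : i < s
  · by_cases hC : i ∈ C <;> cases b <;> simp [initialBits, hi, hC]
  · simp [initialBits, hi]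

theorem take_initialBits (C : Set ℕ) {s t : ℕ} (h : t ≤ s) :
    (initialBits C s).take t = initialBits C t := by
  rw [initialBits, ← List.map_take, List.take_range, min_eq_left h, initialBits]

theorem agreesSet_ofList_initialBits (C : Set ℕ) (s : ℕ) :
    AgreesSet (FinInfo.ofList (initialBits C s)) C := fun _ hp =>
  (initialBits_getElem?_eq_some.1 (FinInfo.mem_ofList.1 hp)).2

theorem eq_initialBits_of_agreesSet_ofList {C : Set ℕ} {l : List Bool}
    (h : AgreesSet (FinInfo.ofList l) C) : l = initialBits C l.length := by
  refine List.ext_getElem? fun i => ?_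
  by_cases hi : i < l.length
  · have hl : l[i]? = some l[i] := List.getElem?_eq_getElem hi
    rw [hl, eq_comm, initialBits_getElem?_eq_some]
    exact ⟨hi, h (i, l[i]) (FinInfo.mem_ofList.2 hl)⟩
  · rw [List.getElem?_eq_none (by omega), List.getElem?_eq_none (by simpa using hi)]

theorem take_eq_take_of_compatible {l l' : List Bool}
    (h : (FinInfo.ofList l).Compatible (FinInfo.ofList l')) {t : ℕ} (ht : t ≤ l.length)
    (ht' : t ≤ l'.length) : l.take t = l'.take t := by
  refine List.ext_getElem (by simp [ht, ht']) fun i hi hi' => ?_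
  simp only [List.length_take, lt_min_iff] at hi hi'
  simp only [List.getElem_take]
  exact h (i, l[i]) (FinInfo.mem_ofList.2 (List.getElem?_eq_getElem hi.2))
    (i, l'[i]) (FinInfo.mem_ofList.2 (List.getElem?_eq_getElem hi'.2)) rfl

/-- The functional that, on input `x` with oracle `C`, searches for the least `t` such that
`g x` is defined on the first `t` bits of `C`, and outputs that value. -/
def TuringFunctional.ofSearch (g : ℕ → List Bool → Option Bool) (hg : Computable₂ g) :
    TuringFunctional where
  axs k := (Encodable.decode (α := ℕ × List Bool) k).bind fun a =>
    (firstSome (fun t => g a.1 (a.2.take t)) a.2.length).map fun b =>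
      (FinInfo.ofList a.2, a.1, b)
  axs_computable := by
    refine Computable.option_bind Computable.decode ?_
    have ha : Computable fun p : ℕ × (ℕ × List Bool) => p.2 := Computable.snd
    refine Computable.option_map
      (Computable.firstSome (h := fun (p : ℕ × (ℕ × List Bool)) t => g p.2.1 (p.2.2.take t))
        (n := fun p => p.2.2.length) ?_ ?_) ?_
    · exact hg.comp (Computable.fst.comp (ha.comp Computable.fst))
        (Primrec.list_take.to_comp.comp Computable.snd
          (Computable.snd.comp (ha.comp Computable.fst)))
    · exact Computable.list_length.comp (Computable.snd.comp ha)
    · exact Computable.pair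
        (FinInfo.primrec_ofList.to_comp.comp
          (Computable.snd.comp (ha.comp Computable.fst)))
        (Computable.pair (Computable.fst.comp (ha.comp Computable.fst)) Computable.snd)
  consistent := by
    intro k₁ k₂ σ₁ σ₂ n b₁ b₂ h₁ h₂ hc
    simp only [Option.bind_eq_some_iff, Option.map_eq_some_iff, Prod.mk.injEq] at h₁ h₂
    obtain ⟨⟨_, l₁⟩, -, c₁, h₁, rfl, rfl, rfl⟩ := h₁
    obtain ⟨⟨_, l₂⟩, -, c₂, h₂, rfl, rfl, rfl⟩ := h₂
    dsimp only at h₁ h₂ hc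
    rcases le_total l₁.length l₂.length with hl | hl
    · rw [firstSome_congr fun t ht => congrArg _
        (take_eq_take_of_compatible hc ht.le (ht.le.trans hl))] at h₁
      exact Option.some.inj ((firstSome_mono hl h₁).symm.trans h₂)
    · rw [firstSome_congr fun t ht => congrArg _
        (take_eq_take_of_compatible hc (ht.le.trans hl) ht.le).symm] at h₂
      exact Option.some.inj (h₁.symm.trans (firstSome_mono hl h₂))

namespace TuringFunctional

theorem ofSearch_haltsT_iff {g : ℕ → List Bool → Option Bool} {hg : Computable₂ g} {C : Set ℕ}
    {x : ℕ} {b : Bool} :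
    (ofSearch g hg).HaltsT C x b ↔
      ∃ s, firstSome (fun t => g x (initialBits C t)) s = some b := by
  have key (s : ℕ) : firstSome (fun t => g x ((initialBits C s).take t)) s =
      firstSome (fun t => g x (initialBits C t)) s :=
    firstSome_congr fun t ht => congrArg _ (take_initialBits C ht.le)
  constructor
  · rintro ⟨k, σ, hk, hσ⟩
    simp only [ofSearch, Option.bind_eq_some_iff, Option.map_eq_some_iff, Prod.mk.injEq] at hk
    obtain ⟨⟨_, l⟩, -, c, h, rfl, rfl, rfl⟩ := hk
    dsimp only at h hσ
    rw [eq_initialBits_of_agreesSet_ofList hσ, length_initialBits, key] at h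
    exact ⟨_, h⟩
  · rintro ⟨s, hs⟩
    refine ⟨Encodable.encode (x, initialBits C s), _, ?_, agreesSet_ofList_initialBits C s⟩
    simp only [ofSearch, Encodable.encodek, Option.bind_some, length_initialBits, key, hs,
      Option.map_some]

theorem exists_of_ofSearch_haltsT {g : ℕ → List Bool → Option Bool} {hg : Computable₂ g}
    {C : Set ℕ} {x : ℕ} {b : Bool} (h : (ofSearch g hg).HaltsT C x b) :
    ∃ s, g x (initialBits C s) = some b := by
  obtain ⟨s, hs⟩ := ofSearch_haltsT_iff.1 h
  obtain ⟨t, -, ht⟩ := exists_eq_of_firstSome_eq_some hs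
  exact ⟨t, ht⟩

theorem exists_ofSearch_haltsT {g : ℕ → List Bool → Option Bool} {hg : Computable₂ g}
    {C : Set ℕ} {x s : ℕ} {b : Bool} (h : g x (initialBits C s) = some b) :
    ∃ b', (ofSearch g hg).HaltsT C x b' := by
  obtain ⟨b', hb'⟩ :=
    exists_firstSome_succ_eq_some (h := fun t => g x (initialBits C t)) h
  exact ⟨b', ofSearch_haltsT_iff.2 ⟨_, hb'⟩⟩

/-- The output, on input `u x`, of the axiom of `Φ` whose index is the first component of
`l.length`, provided that `a (x, l)` answers the queries as that axiom prescribes. -/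
def tryAxiom (Φ : TuringFunctional) (u : ℕ → ℕ) (a : ℕ × List Bool → ℕ → Option Bool)
    (x : ℕ) (l : List Bool) : Option Bool :=
  (Φ.axs l.length.unpair.1).bind fun r =>
    if r.2.1 = u x ∧ ∀ p ∈ r.1, a (x, l) p.1 = some p.2 then some r.2.2 else none

theorem tryAxiom_eq_some {Φ : TuringFunctional} {u : ℕ → ℕ}
    {a : ℕ × List Bool → ℕ → Option Bool} {x : ℕ} {l : List Bool} {b : Bool} :
    Φ.tryAxiom u a x l = some b ↔ ∃ σ, Φ.axs l.length.unpair.1 = some (σ, u x, b) ∧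
      ∀ p ∈ σ, a (x, l) p.1 = some p.2 := by
  simp only [tryAxiom, Option.bind_eq_some_iff, Option.ite_none_right_eq_some,
    Option.some.injEq]
  constructor
  · rintro ⟨⟨σ, _, _⟩, h, ⟨rfl, hσ⟩, rfl⟩
    exact ⟨σ, h, hσ⟩
  · rintro ⟨σ, h, hσ⟩
    exact ⟨_, h, ⟨rfl, hσ⟩, rfl⟩

theorem computable_tryAxiom (Φ : TuringFunctional) {u : ℕ → ℕ} (hu : Primrec u)
    {a : ℕ × List Bool → ℕ → Option Bool} (ha : Primrec₂ a) :
    Computable₂ (Φ.tryAxiom u a) := by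
  refine Computable.option_bind (Φ.axs_computable.comp (Computable.fst.comp
    (Computable.unpair.comp (Computable.list_length.comp Computable.snd)))) ?_
  refine Primrec.to_comp (Primrec.ite (PrimrecPred.and ?_ ?_) ?_ (Primrec.const none))
  · exact Primrec.eq.comp (Primrec.fst.comp (Primrec.snd.comp Primrec.snd))
      (hu.comp (Primrec.fst.comp Primrec.fst))
  · have hR : PrimrecRel fun (p : ℕ × Bool) (y : ℕ × List Bool) => a y p.1 = some p.2 :=
      Primrec.eq.comp (ha.comp Primrec.snd (Primrec.fst.comp Primrec.fst))
        (Primrec.option_some.comp (Primrec.snd.comp Primrec.fst))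
    exact hR.forall_mem_list.comp (Primrec.fst.comp Primrec.snd) Primrec.fst
  · exact Primrec.option_some.comp (Primrec.snd.comp (Primrec.snd.comp Primrec.snd))

end TuringFunctional

theorem primrec_two_pow : Primrec fun n : ℕ => 2 ^ n := by
  have hmul : Primrec₂ fun _ r : ℕ => 2 * r :=
    Primrec.nat_mul.comp (Primrec.const 2) Primrec.snd
  refine (Primrec.nat_rec₁ 1 hmul).of_eq fun n => ?_
  induction n with
  | zero => rfl
  | succ n ih => simp only [ih, pow_succ']

theorem findGreatest_two_pow_dvd (x : ℕ) :
    x.findGreatest (fun k => 2 ^ k ∣ x) = padicValNat 2 x := by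
  rcases eq_or_ne x 0 with rfl | hx
  · simp
  · refine Nat.findGreatest_eq_iff.2 ⟨?_, fun _ => pow_padicValNat_dvd, fun n hn _ h => ?_⟩
    · exact (padicValNat_le_nat_log x).trans (Nat.log_le_self 2 x)
    · exact absurd ((padicValNat_dvd_iff_le hx).1 h) (by omega)

theorem primrec_padicValNat_two : Primrec (padicValNat 2) := by
  have hdvd : PrimrecRel fun x k : ℕ => 2 ^ k ∣ x :=
    (Primrec.eq.comp (Primrec.nat_mod.comp Primrec.fst (primrec_two_pow.comp Primrec.snd))
      (Primrec.const 0)).of_eq fun _ => Nat.dvd_iff_mod_eq_zero.symm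
  exact (Primrec.nat_findGreatest Primrec.id hdvd).of_eq findGreatest_two_pow_dvd

theorem padicValNat_two_pow_mul_odd (n : ℕ) {m : ℕ} (hm : Odd m) :
    padicValNat 2 (2 ^ n * m) = n := by
  rw [padicValNat.mul (by positivity) hm.pos.ne', padicValNat.prime_pow,
    padicValNat.eq_zero_of_not_dvd hm.not_two_dvd_nat, add_zero]

theorem mem_Rmap_iff {S : Set ℕ} {x : ℕ} : x ∈ Rmap S ↔ x ≠ 0 ∧ padicValNat 2 x ∈ S := by
  constructor
  · rintro ⟨n, hn, m, hm, rfl⟩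
    exact ⟨mul_ne_zero (by positivity) hm.pos.ne', by rwa [padicValNat_two_pow_mul_odd n hm]⟩
  · rintro ⟨hx, h⟩
    obtain ⟨k, m, hm, rfl⟩ := Nat.exists_eq_two_pow_mul_odd hx
    exact ⟨k, by rwa [padicValNat_two_pow_mul_odd k hm] at h, m, hm, rfl⟩

theorem two_pow_mul_odd_mem_Rmap_iff {S : Set ℕ} {n m : ℕ} (hm : Odd m) :
    2 ^ n * m ∈ Rmap S ↔ n ∈ S := by
  rw [mem_Rmap_iff, padicValNat_two_pow_mul_odd n hm]
  exact and_iff_right (mul_ne_zero (by positivity) hm.pos.ne')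

/-- Turing reducibility of `R(B)` to `R(A)` implies Turing reducibility of `B` to `A`. -/
theorem TuringRed.of_Rmap {A B : Set ℕ} (h : TuringRed (Rmap B) (Rmap A)) : TuringRed B A := by
  obtain ⟨Φ, htot, hval⟩ := h
  let a : ℕ × List Bool → ℕ → Option Bool := fun y p =>
    if p = 0 then some false else y.2[padicValNat 2 p]?
  have ha : Primrec₂ a := Primrec.ite (Primrec.eq.comp Primrec.snd (Primrec.const 0))
    (Primrec.const (some false))
    (Primrec.list_getElem?.comp (Primrec.snd.comp Primrec.fst)
      (primrec_padicValNat_two.comp Primrec.snd))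
  have ha_some {x s p : ℕ} {b : Bool} (h : a (x, initialBits A s) p = some b) :
      b = true ↔ p ∈ Rmap A := by
    by_cases hp : p = 0
    · simp_all [a, mem_Rmap_iff]
    · simp only [a, hp, if_false, initialBits_getElem?_eq_some] at h
      simp [mem_Rmap_iff, hp, h.2]
  have ha_of {x s p : ℕ} {b : Bool} (hs : p ≤ s) (h : b = true ↔ p ∈ Rmap A) :
      a (x, initialBits A s) p = some b := by
    by_cases hp : p = 0
    · simp_all [a, mem_Rmap_iff]
    · have hlt : padicValNat 2 p < p :=
        (padicValNat_le_nat_log p).trans_lt (Nat.log_lt_self 2 hp)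
      simp only [a, hp, if_false, initialBits_getElem?_eq_some]
      exact ⟨by omega, by simpa [mem_Rmap_iff, hp] using h⟩
  refine ⟨.ofSearch _ (Φ.computable_tryAxiom primrec_two_pow ha), fun n => ?_, fun n b hb => ?_⟩
  · obtain ⟨b, k, σ, hk, hσ⟩ := htot (2 ^ n)
    obtain ⟨N, hN⟩ := (σ.map Prod.fst).toFinset.exists_le
    refine TuringFunctional.exists_ofSearch_haltsT (s := Nat.pair k N) (b := b) ?_
    refine TuringFunctional.tryAxiom_eq_some.2 ⟨σ, by simpa using hk, fun p hp => ?_⟩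
    refine ha_of ((hN p.1 ?_).trans (Nat.right_le_pair k N)) (hσ p hp)
    exact List.mem_toFinset.2 (List.mem_map_of_mem hp)
  · obtain ⟨s, hs⟩ := TuringFunctional.exists_of_ofSearch_haltsT hb
    obtain ⟨σ, hk, hσ⟩ := TuringFunctional.tryAxiom_eq_some.1 hs
    rw [hval (2 ^ n) b ⟨_, σ, hk, fun p hp => ha_some (hσ p hp)⟩]
    simpa using two_pow_mul_odd_mem_Rmap_iff (S := B) (n := n) odd_one

/-- If `B` is Turing reducible to `A`, then `R(B)` is mod-finite reducible to `R(A)`. On input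
`x`, the reduction simulates in parallel, for all `y`, computations that read the bit `A(p)` at
the position `2 ^ p * (2 * (x + y) + 1)` of the oracle. -/
theorem TuringRed.modFinRed_Rmap {A B : Set ℕ} (h : TuringRed B A) :
    ModFinRed (Rmap B) (Rmap A) := by
  obtain ⟨Φ, htot, hval⟩ := h
  let pos (z p : ℕ) : ℕ := 2 ^ p * (2 * z + 1)
  have le_pos (z p : ℕ) : z ≤ pos z p :=
    (show z ≤ 2 * z + 1 by omega).trans (Nat.le_mul_of_pos_left _ (by positivity))
  have pos_mem (z p : ℕ) : pos z p ∈ Rmap A ↔ p ∈ A :=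
    two_pow_mul_odd_mem_Rmap_iff (odd_two_mul_add_one z)
  let a : ℕ × List Bool → ℕ → Option Bool := fun y p =>
    y.2[pos (y.1 + y.2.length.unpair.2.unpair.1) p]?
  have ha : Primrec₂ a := by
    refine Primrec.list_getElem?.comp (Primrec.snd.comp Primrec.fst)
      (Primrec.nat_mul.comp (primrec_two_pow.comp Primrec.snd)
        (Primrec.succ.comp (Primrec.nat_mul.comp (Primrec.const 2)
          (Primrec.nat_add.comp (Primrec.fst.comp Primrec.fst) ?_))))
    exact Primrec.fst.comp (Primrec.unpair.comp (Primrec.snd.comp (Primrec.unpair.comp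
      (Primrec.list_length.comp (Primrec.snd.comp Primrec.fst)))))
  let g (x : ℕ) (l : List Bool) : Option Bool :=
    (Φ.tryAxiom (padicValNat 2) a x l).map fun b => b && decide (x ≠ 0)
  have hg : Computable₂ g := by
    refine Computable.option_map (Φ.computable_tryAxiom primrec_padicValNat_two ha)
      (Primrec.to_comp (Primrec.and.comp Primrec.snd (PrimrecPred.decide ?_)))
    exact (Primrec.eq.comp (Primrec.fst.comp Primrec.fst) (Primrec.const 0)).not
  have hTotal {C : Set ℕ} (hC : {n | ¬(n ∈ C ↔ n ∈ Rmap A)}.Finite) :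
      (TuringFunctional.ofSearch g hg).TotalOn C := by
    intro x
    obtain ⟨b, k, σ, hk, hσ⟩ := htot (padicValNat 2 x)
    obtain ⟨y, hy⟩ := hC.bddAbove
    obtain ⟨N, hN⟩ := (σ.map fun p => pos (x + (y + 1)) p.1).toFinset.exists_le
    refine TuringFunctional.exists_ofSearch_haltsT
      (s := Nat.pair k (Nat.pair (y + 1) (N + 1))) (b := b && decide (x ≠ 0)) ?_
    refine Option.map_eq_some_iff.2 ⟨b, TuringFunctional.tryAxiom_eq_some.2
      ⟨σ, by simpa using hk, fun p hp => ?_⟩, rfl⟩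
    simp only [a, length_initialBits, Nat.unpair_pair, initialBits_getElem?_eq_some]
    constructor
    · have h₁ := hN _ (List.mem_toFinset.2 (List.mem_map_of_mem hp))
      have h₂ := Nat.right_le_pair k (Nat.pair (y + 1) (N + 1))
      have h₃ := Nat.right_le_pair (y + 1) (N + 1)
      omega
    · rw [hσ p hp, ← pos_mem (x + (y + 1)) p.1]
      by_contra hne
      have h₁ := hy (show _ ∈ {n | ¬(n ∈ C ↔ n ∈ Rmap A)} from fun h => hne h.symm)
      have h₂ := le_pos (x + (y + 1)) p.1
      omega
  have hVal {C : Set ℕ} {x : ℕ} {b : Bool} (hx : ∀ z ≥ x, z ∈ C ↔ z ∈ Rmap A)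
      (hb : (TuringFunctional.ofSearch g hg).HaltsT C x b) : b = true ↔ x ∈ Rmap B := by
    obtain ⟨s, hs⟩ := TuringFunctional.exists_of_ofSearch_haltsT hb
    obtain ⟨c, hc, rfl⟩ := Option.map_eq_some_iff.1 hs
    obtain ⟨σ, hk, hσ⟩ := TuringFunctional.tryAxiom_eq_some.1 hc
    have := hval _ c ⟨_, σ, hk, fun p hp => by
      have hp' := (initialBits_getElem?_eq_some.1 (hσ p hp)).2
      rwa [hx _ ((Nat.le_add_right _ _).trans (le_pos _ _)), pos_mem] at hp'⟩
    simp [mem_Rmap_iff, this, and_comm]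
  refine ⟨.ofSearch g hg, ⟨hTotal (by simp), fun x b => hVal fun _ _ => Iff.rfl⟩,
    fun C hC => ⟨hTotal hC, ?_⟩⟩
  obtain ⟨y, hy⟩ := hC.bddAbove
  refine (Set.finite_Iic y).subset fun x hx => ?_
  by_contra hxy
  obtain ⟨b, hb⟩ := hTotal hC x
  refine hx ⟨b, hb, hVal (fun z hz => ?_) hb⟩
  by_contra hne
  exact hxy ((show x ≤ z from hz).trans (hy hne))

theorem turing_red_iff_mod_finite_red_Rmap (A B : Set ℕ) :
    TuringRed B A ↔ ModFinRed (Rmap B) (Rmap A) :=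
  ⟨TuringRed.modFinRed_Rmap, fun ⟨Φ, hΦ, _⟩ => TuringRed.of_Rmap ⟨Φ, hΦ⟩⟩
end
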